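/- Define nstc(sigma) = stc(sigma) + neg(sigma) for sigma in B_n, where stc(sigma) is Skandera's statistic applied to the signed permutation (defined via the inversion set of sigma on positions, equivalently stc of the underlying relative-order permutation). Then sum over sigma in B_n of x^{nstc(sigma)} q^{ell(sigma)} equals sum over sigma in B_n of x^{ndes(sigma)} q^{nmaj(sigma)}, where ndes(sigma) = des(sigma) + neg(sigma) and nmaj(sigma) = maj(sigma) - sum over i in Neg(sigma) of sigma(i). -/

import Mathlib

open Finset

/-- Descent set of a word (1-based positions: `i ∈ desSet w` iff `1 ≤ i ≤ n-1` and `w_i > w_{i+1}`). -/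
def desSet {α : Type*} [LinearOrder α] {n : ℕ} (w : Fin n → α) : Finset ℕ :=
  (Finset.Ico 1 n).filter fun i =>
    ∃ h : i < n, w ⟨i, h⟩ < w ⟨i - 1, Nat.lt_of_le_of_lt (Nat.sub_le i 1) h⟩

def desStat {α : Type*} [LinearOrder α] {n : ℕ} (w : Fin n → α) : ℕ := (desSet w).card

def majStat {α : Type*} [LinearOrder α] {n : ℕ} (w : Fin n → α) : ℕ := ∑ i ∈ desSet w, i

def invStat {α : Type*} [LinearOrder α] {n : ℕ} (w : Fin n → α) : ℕ :=
  ((Finset.univ : Finset (Fin n × Fin n)).filter fun p => p.1 < p.2 ∧ w p.2 < w p.1).card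

/-- Lehmer code. -/
def lehmer {α : Type*} [LinearOrder α] {n : ℕ} (w : Fin n → α) (i : Fin n) : ℕ :=
  (Finset.univ.filter fun j => i < j ∧ w j < w i).card

/-- `c` contains a subsequence of length `r` which is entrywise strictly greater than
the staircase `(r-1, r-2, ..., 1, 0)`, i.e. the entry at (1-based) place `k` exceeds `r - k`. -/
def hasStaircase {n : ℕ} (c : Fin n → ℕ) (r : ℕ) : Prop :=
  ∃ f : Fin r → Fin n, StrictMono f ∧ ∀ k : Fin r, r < c (f k) + (k : ℕ) + 1

noncomputable def stcWord {n : ℕ} (c : Fin n → ℕ) : ℕ := sSup {r | hasStaircase c r}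

noncomputable def stcStat {α : Type*} [LinearOrder α] {n : ℕ} (w : Fin n → α) : ℕ := stcWord (lehmer w)

noncomputable abbrev PP := Polynomial (Polynomial ℤ)
noncomputable def xP : PP := Polynomial.X
noncomputable def qP : PP := Polynomial.C Polynomial.X

/-- Number of negative entries of a word. -/
def negStat {n : ℕ} (w : Fin n → ℤ) : ℕ := (Finset.univ.filter fun i => w i < 0).card

/-- Number of negative sum pairs of a word. -/
def nspStat {n : ℕ} (w : Fin n → ℤ) : ℕ :=
  ((Finset.univ : Finset (Fin n × Fin n)).filter fun p => p.1 < p.2 ∧ w p.1 + w p.2 < 0).card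

/-- The hyperoctahedral group `B_n`, encoded as pairs (permutation, signs). -/
abbrev SignedPerm (n : ℕ) := Equiv.Perm (Fin n) × (Fin n → Bool)

/-- The window `σ(1) ⋯ σ(n) ∈ {±1, …, ±n}ⁿ` of a signed permutation. -/
def sgnWord {n : ℕ} (σ : SignedPerm n) : Fin n → ℤ :=
  fun i => if σ.2 i then -((σ.1 i : ℤ) + 1) else (σ.1 i : ℤ) + 1

/-- The type `B` Coxeter length, via its combinatorial description
`ℓ(σ) = inv(σ) + neg(σ) + nsp(σ)`. -/
def lenB {n : ℕ} (σ : SignedPerm n) : ℕ :=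
  invStat (sgnWord σ) + negStat (sgnWord σ) + nspStat (sgnWord σ)

/-- `nstc(σ) = stc(σ) + neg(σ)`; here `stc` of a signed permutation is Skandera's
statistic of its window (equivalently, of the ordinary permutation with the same
relative order of values, since the Lehmer code only depends on relative order). -/
noncomputable def nstc {n : ℕ} (σ : SignedPerm n) : ℕ :=
  stcStat (sgnWord σ) + negStat (sgnWord σ)

/-- `ndes(σ) = des(σ) + neg(σ)`. -/
def ndes {n : ℕ} (σ : SignedPerm n) : ℕ := desStat (sgnWord σ) + negStat (sgnWord σ)

/-- `nmaj(σ) = maj(σ) - ∑_{i ∈ Neg σ} σ(i)`. -/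
def nmaj {n : ℕ} (σ : SignedPerm n) : ℕ :=
  majStat (sgnWord σ) +
    ∑ i ∈ Finset.univ.filter (fun i : Fin n => sgnWord σ i < 0), (sgnWord σ i).natAbs

/-! ### Inserting a letter into a permutation -/

lemma ins_inj {n : ℕ} (p a : Fin (n+1)) (t : Equiv.Perm (Fin n)) :
    Function.Injective (Fin.insertNth p a (fun i => a.succAbove (t i)) : Fin (n+1) → Fin (n+1)) := by
  intro i j h
  induction i using Fin.succAboveCases p with
  | x =>
    induction j using Fin.succAboveCases p with
    | x => rfl
    | p j => simp at h
  | p i =>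
    induction j using Fin.succAboveCases p with
    | x => simp at h
    | p j => simpa using h

noncomputable def insP {n : ℕ} (p a : Fin (n+1)) (t : Equiv.Perm (Fin n)) : Equiv.Perm (Fin (n+1)) :=
  Equiv.ofBijective _ (Finite.injective_iff_bijective.1 (ins_inj p a t))

lemma insP_coe {n : ℕ} (p a : Fin (n+1)) (t : Equiv.Perm (Fin n)) :
    (insP p a t : Fin (n+1) → Fin (n+1)) = Fin.insertNth p a (fun i => a.succAbove (t i)) := rfl

@[simp] lemma insP_same {n : ℕ} (p a : Fin (n+1)) (t : Equiv.Perm (Fin n)) : insP p a t p = a := by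
  simp [insP_coe]

@[simp] lemma insP_above {n : ℕ} (p a : Fin (n+1)) (t : Equiv.Perm (Fin n)) (i : Fin n) :
    insP p a t (p.succAbove i) = a.succAbove (t i) := by
  simp [insP_coe]

lemma sum_insP_val {n : ℕ} {M : Type*} [AddCommMonoid M] (p : Fin (n+1))
    (F : Equiv.Perm (Fin (n+1)) → M) :
    ∑ s, F s = ∑ t : Equiv.Perm (Fin n), ∑ a : Fin (n+1), F (insP p a t) := by
  rw [← Finset.sum_product' (f := fun t a => F (insP p a t))]
  symm
  refine Function.Bijective.sum_comp (e := fun x : Equiv.Perm (Fin n) × Fin (n+1) => insP p x.2 x.1) ?_ F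
  rw [Fintype.bijective_iff_injective_and_card]
  constructor
  · rintro ⟨t, a⟩ ⟨t', a'⟩ h
    have h : insP p a t = insP p a' t' := h
    have ha : a = a' := by
      have := congrArg (fun s => s p) h
      simpa using this
    subst ha
    have : t = t' := by
      ext i
      have := congrArg (fun s => s (p.succAbove i)) h
      simp at this
      rw [this]
    rw [this]
  · simp [Fintype.card_perm, Nat.factorial_succ, mul_comm]

lemma sum_insP_pos {n : ℕ} {M : Type*} [AddCommMonoid M] (a : Fin (n+1))
    (F : Equiv.Perm (Fin (n+1)) → M) :
    ∑ s, F s = ∑ t : Equiv.Perm (Fin n), ∑ p : Fin (n+1), F (insP p a t) := by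
  rw [← Finset.sum_product' (f := fun t p => F (insP p a t))]
  symm
  refine Function.Bijective.sum_comp (e := fun x : Equiv.Perm (Fin n) × Fin (n+1) => insP x.2 a x.1) ?_ F
  rw [Fintype.bijective_iff_injective_and_card]
  constructor
  · rintro ⟨t, p⟩ ⟨t', p'⟩ h
    have h : insP p a t = insP p' a t' := h
    have ha : p = p' := by
      apply (insP p a t).injective
      rw [insP_same, h, insP_same]
    subst ha
    have : t = t' := by
      ext i
      have := congrArg (fun s => s (p.succAbove i)) h
      simp at this
      rw [this]
    rw [this]
  · simp [Fintype.card_perm, Nat.factorial_succ, mul_comm]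

/-! ### The staircase side -/

lemma insP_zero_zero {n : ℕ} (a : Fin (n+1)) (t : Equiv.Perm (Fin n)) : insP 0 a t 0 = a :=
  insP_same 0 a t

lemma insP_zero_succ {n : ℕ} (a : Fin (n+1)) (t : Equiv.Perm (Fin n)) (i : Fin n) :
    insP 0 a t i.succ = a.succAbove (t i) := by
  have := insP_above 0 a t i
  simpa using this

lemma lehmer_ins_zero {n : ℕ} (a : Fin (n+1)) (t : Equiv.Perm (Fin n)) :
    lehmer (insP 0 a t) 0 = a := by
  have h1 : (Finset.univ.filter fun j : Fin (n+1) => 0 < j ∧ insP 0 a t j < insP 0 a t 0)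
      = (Finset.Iio a).map (insP 0 a t).symm.toEmbedding := by
    ext j
    simp only [Finset.mem_filter, Finset.mem_univ, true_and, Finset.mem_map_equiv,
      Equiv.symm_symm, Finset.mem_Iio, insP_zero_zero]
    constructor
    · exact fun h => h.2
    · intro h
      refine ⟨?_, h⟩
      rw [Fin.pos_iff_ne_zero]
      rintro rfl
      rw [insP_zero_zero] at h
      exact lt_irrefl _ h
  unfold lehmer
  rw [h1, Finset.card_map, Fin.card_Iio]

lemma lehmer_ins_succ {n : ℕ} (a : Fin (n+1)) (t : Equiv.Perm (Fin n)) (i : Fin n) :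
    lehmer (insP 0 a t) i.succ = lehmer t i := by
  unfold lehmer
  rw [← Finset.card_map (Fin.succEmb n)]
  congr 1
  ext j
  induction j using Fin.cases with
  | zero => simp
  | succ j => simp [insP_zero_succ]

lemma inv_eq_sum {α : Type*} [LinearOrder α] {n : ℕ} (w : Fin n → α) :
    invStat w = ∑ i, lehmer w i := by
  unfold invStat lehmer
  simp_rw [Finset.card_filter]
  rw [← Finset.univ_product_univ, Finset.sum_product]

lemma inv_ins {n : ℕ} (a : Fin (n+1)) (t : Equiv.Perm (Fin n)) :
    invStat (insP 0 a t) = invStat t + a := by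
  rw [inv_eq_sum, inv_eq_sum, Fin.sum_univ_succ, lehmer_ins_zero]
  simp_rw [lehmer_ins_succ]
  ring

lemma stair_bdd {n : ℕ} (c : Fin n → ℕ) : BddAbove {r | hasStaircase c r} := by
  refine ⟨n, ?_⟩
  rintro r ⟨f, hf, -⟩
  simpa using Fintype.card_le_of_injective f hf.injective

lemma stair_zero {n : ℕ} (c : Fin n → ℕ) : hasStaircase c 0 :=
  ⟨Fin.elim0, fun i => i.elim0, fun i => i.elim0⟩

lemma stair_stc {n : ℕ} (c : Fin n → ℕ) : hasStaircase c (stcWord c) :=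
  Nat.sSup_mem ⟨0, stair_zero c⟩ (stair_bdd c)

lemma stair_le {n : ℕ} {c : Fin n → ℕ} {r : ℕ} (h : hasStaircase c r) : r ≤ stcWord c :=
  le_csSup (stair_bdd c) h

lemma stair_lift {n : ℕ} {c : Fin (n+1) → ℕ} {r : ℕ} (h : hasStaircase (fun i => c (Fin.succ i)) r) :
    hasStaircase c r := by
  obtain ⟨f, hf, h⟩ := h
  exact ⟨fun k => (f k).succ, fun i j hij => Fin.succ_lt_succ_iff.2 (hf hij), h⟩

lemma stair_cons {n : ℕ} {c : Fin (n+1) → ℕ} {r : ℕ} (h : hasStaircase (fun i => c (Fin.succ i)) r)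
    (h0 : r < c 0) : hasStaircase c (r+1) := by
  obtain ⟨f, hf, h⟩ := h
  refine ⟨Fin.cons 0 (fun k => (f k).succ), ?_, ?_⟩
  · intro i j hij
    induction j using Fin.cases with
    | zero => simp at hij
    | succ j =>
      induction i using Fin.cases with
      | zero => simp
      | succ i => simpa using hf (by simpa using hij)
  · intro k
    induction k using Fin.cases with
    | zero => simpa using h0
    | succ k =>
      have := h k
      simp
      omega

/-- a staircase of the tail is obtained by dropping the first letter -/
lemma stair_tail {n : ℕ} {c : Fin (n+1) → ℕ} {r : ℕ} (h : hasStaircase c (r+1)) :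
    hasStaircase (fun i => c (Fin.succ i)) r := by
  obtain ⟨f, hf, h⟩ := h
  have hne : ∀ k : Fin r, f k.succ ≠ 0 := fun k => by
    have := hf (Fin.succ_pos k)
    exact (Fin.pos_iff_ne_zero).1 (lt_of_le_of_lt (Fin.zero_le _) this)
  refine ⟨fun k => (f k.succ).pred (hne k), ?_, ?_⟩
  · intro i j hij
    simpa using hf (by simpa using hij)
  · intro k
    have := h k.succ
    simp at this ⊢
    omega

lemma stair_dich {n : ℕ} {c : Fin (n+1) → ℕ} {r : ℕ} (h : hasStaircase c (r+1)) :
    r < c 0 ∨ hasStaircase (fun i => c (Fin.succ i)) (r+1) := by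
  obtain ⟨f, hf, h⟩ := h
  by_cases h0 : f 0 = 0
  · left
    have := h 0
    rw [h0] at this
    simpa using this
  · right
    have hne : ∀ k : Fin (r+1), f k ≠ 0 := fun k hk => by
      have := hf.monotone (Fin.zero_le k)
      rw [hk] at this
      exact h0 (le_antisymm this (Fin.zero_le _))
    refine ⟨fun k => (f k).pred (hne k), ?_, ?_⟩
    · intro i j hij
      simpa using hf hij
    · intro k
      simpa using h k

lemma stcWord_succ {n : ℕ} (c : Fin (n+1) → ℕ) :
    stcWord c = stcWord (fun i => c (Fin.succ i)) +
      if stcWord (fun i => c (Fin.succ i)) < c 0 then 1 else 0 := by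
  set d := stcWord (fun i => c (Fin.succ i)) with hd
  have h1 : hasStaircase (fun i => c (Fin.succ i)) d := stair_stc _
  have h2 := stair_le (stair_lift h1)
  have h3 : stcWord c ≤ d + 1 := by
    by_contra hlt
    have h4 := stair_stc c
    obtain ⟨r, hr⟩ : ∃ r, stcWord c = r + 1 := ⟨stcWord c - 1, by omega⟩
    rw [hr] at h4
    have := stair_le (stair_tail h4)
    omega
  split_ifs with h
  · have := stair_le (stair_cons h1 h)
    omega
  · by_contra hne
    have h4 := stair_stc c
    have h5 : stcWord c = d + 1 := by omega
    rw [h5] at h4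
    rcases stair_dich h4 with h6 | h6
    · exact h h6
    · have := stair_le h6
      omega

lemma stc_ins {n : ℕ} (a : Fin (n+1)) (t : Equiv.Perm (Fin n)) :
    stcStat (insP 0 a t) = stcStat t + if stcStat t < a then 1 else 0 := by
  unfold stcStat
  rw [stcWord_succ, lehmer_ins_zero]
  simp_rw [lehmer_ins_succ]

/-! ### The descent side -/

/-- increment of the major index when a maximal letter is inserted at place `p` -/
def kfun (n : ℕ) (D : Finset ℕ) (p : ℕ) : ℕ :=
  if p ∈ insert n D then ((insert n D).filter (fun i => p < i)).card
  else D.card + 1 + ((Finset.range p).filter (fun i => i ∉ insert n D)).card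

lemma kfun_mem {n : ℕ} {D : Finset ℕ} (hn : n ∉ D) {p : ℕ} (hp : p ∈ insert n D) :
    kfun n D p ≤ D.card := by
  unfold kfun
  rw [if_pos hp]
  have : ((insert n D).filter (fun i => p < i)) ⊂ insert n D := by
    rw [Finset.filter_ssubset]
    exact ⟨p, hp, lt_irrefl _⟩
  have := Finset.card_lt_card this
  rw [Finset.card_insert_of_notMem hn] at this
  omega

lemma kfun_notMem {n : ℕ} {D : Finset ℕ} {p : ℕ} (hp : p ∉ insert n D) :
    D.card < kfun n D p := by
  unfold kfun
  rw [if_neg hp]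
  omega

lemma kfun_anti {n : ℕ} {D : Finset ℕ} {p p' : ℕ} (hp : p ∈ insert n D) (hp' : p' ∈ insert n D)
    (h : p < p') : kfun n D p' < kfun n D p := by
  unfold kfun
  rw [if_pos hp, if_pos hp']
  apply Finset.card_lt_card
  rw [Finset.ssubset_iff_of_subset]
  · refine ⟨p', ?_, ?_⟩
    · simp only [Finset.mem_filter]; exact ⟨hp', h⟩
    · simp
  · intro i hi
    simp only [Finset.mem_filter] at hi ⊢
    exact ⟨hi.1, h.trans hi.2⟩

lemma kfun_mono {n : ℕ} {D : Finset ℕ} {p p' : ℕ} (hp : p ∉ insert n D) (hp' : p' ∉ insert n D)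
    (h : p < p') : kfun n D p < kfun n D p' := by
  unfold kfun
  rw [if_neg hp, if_neg hp']
  apply Nat.add_lt_add_left
  apply Finset.card_lt_card
  rw [Finset.ssubset_iff_of_subset]
  · refine ⟨p, ?_, ?_⟩
    · simp only [Finset.mem_filter, Finset.mem_range]; exact ⟨h, hp⟩
    · simp
  · intro i hi
    simp only [Finset.mem_filter, Finset.mem_range] at hi ⊢
    exact ⟨hi.1.trans h, hi.2⟩

lemma kfun_inj {n : ℕ} {D : Finset ℕ} (hn : n ∉ D) : Function.Injective (kfun n D) := by
  intro p p' h
  by_cases hp : p ∈ insert n D <;> by_cases hp' : p' ∈ insert n D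
  · rcases lt_trichotomy p p' with h1 | h1 | h1
    · have := kfun_anti hp hp' h1; omega
    · exact h1
    · have := kfun_anti hp' hp h1; omega
  · have := kfun_mem hn hp; have := kfun_notMem hp'; omega
  · have := kfun_mem hn hp'; have := kfun_notMem hp; omega
  · rcases lt_trichotomy p p' with h1 | h1 | h1
    · have := kfun_mono hp hp' h1; omega
    · exact h1
    · have := kfun_mono hp' hp h1; omega

lemma kfun_formula {n : ℕ} {D : Finset ℕ} (hD : ∀ i ∈ D, i < n) {p : ℕ} (hp : p < n) (hpD : p ∉ D) :
    kfun n D p = p + 1 + (D.filter (fun i => p < i)).card := by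
  unfold kfun
  have h1 : p ∉ insert n D := by simp [hpD]; omega
  rw [if_neg h1]
  have h2 : D.card = (D.filter (fun i => p < i)).card + (D.filter (fun i => ¬ p < i)).card :=
    (Finset.card_filter_add_card_filter_not _).symm
  have h3 : D.filter (fun i => ¬ p < i) = (Finset.range p).filter (fun i => i ∈ insert n D) := by
    ext i
    simp only [Finset.mem_filter, Finset.mem_range, Finset.mem_insert]
    constructor
    · rintro ⟨h, h'⟩
      refine ⟨?_, Or.inr h⟩
      have : i ≠ p := by rintro rfl; exact hpD h
      omega
    · rintro ⟨h, h' | h'⟩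
      · omega
      · exact ⟨h', by omega⟩
  have h4 : p = ((Finset.range p).filter (fun i => i ∈ insert n D)).card
      + ((Finset.range p).filter (fun i => i ∉ insert n D)).card := by
    rw [Finset.card_filter_add_card_filter_not, Finset.card_range]
  rw [h3] at h2
  omega

lemma kfun_formula' {n : ℕ} {D : Finset ℕ} (hD : ∀ i ∈ D, i < n) {p : ℕ} (hpD : p ∈ D) :
    kfun n D p = 1 + (D.filter (fun i => p < i)).card := by
  unfold kfun
  have h1 : p ∈ insert n D := by simp [hpD]
  rw [if_pos h1, Finset.filter_insert, if_pos (hD p hpD), Finset.card_insert_of_notMem]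
  · omega
  · intro h
    have := hD n (Finset.mem_filter.1 h).1
    omega

lemma kfun_n {n : ℕ} {D : Finset ℕ} (hD : ∀ i ∈ D, i < n) : kfun n D n = 0 := by
  unfold kfun
  rw [if_pos (by simp), Finset.card_eq_zero, Finset.filter_eq_empty_iff]
  intro i hi
  simp only [Finset.mem_insert] at hi
  rcases hi with rfl | hi
  · omega
  · have := hD i hi; omega

lemma kfun_le {n : ℕ} {D : Finset ℕ} (hD : ∀ i ∈ D, i < n) {p : ℕ} (hp : p ≤ n) :
    kfun n D p ≤ n := by
  have hb : ∀ q, (D.filter (fun i => q < i)).card ≤ n - 1 - q := by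
    intro q
    calc (D.filter (fun i => q < i)).card ≤ (Finset.Ioc q (n-1)).card := by
          apply Finset.card_le_card
          intro i hi
          simp only [Finset.mem_filter, Finset.mem_Ioc] at hi ⊢
          have := hD i hi.1
          omega
      _ = n - 1 - q := by simp
  rcases hp.lt_or_eq with h | rfl
  · have := hb p
    by_cases hpD : p ∈ D
    · rw [kfun_formula' hD hpD]; omega
    · rw [kfun_formula hD h hpD]; omega
  · rw [kfun_n hD]; omega

lemma sum_kfun {n : ℕ} {D : Finset ℕ} (hD : ∀ i ∈ D, i < n) {M : Type*} [AddCommMonoid M]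
    (G : ℕ → M) : ∑ p : Fin (n+1), G (kfun n D p) = ∑ k : Fin (n+1), G k := by
  have hn : n ∉ D := fun h => lt_irrefl _ (hD n h)
  let e : Fin (n+1) → Fin (n+1) := fun p => ⟨kfun n D p, by
    have := kfun_le hD (Nat.lt_succ_iff.1 p.2); omega⟩
  have he : Function.Injective e := by
    intro p p' h
    have h : kfun n D p = kfun n D p' := congrArg Fin.val h
    exact Fin.ext (kfun_inj hn h)
  exact Function.Bijective.sum_comp (Finite.injective_iff_bijective.1 he) (fun k => G k)

lemma mem_desSet {α : Type*} [LinearOrder α] {n : ℕ} (w : Fin n → α) (i : ℕ) :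
    i ∈ desSet w ↔ 1 ≤ i ∧ ∃ (h : i < n) (h' : i - 1 < n), w ⟨i, h⟩ < w ⟨i-1, h'⟩ := by
  unfold desSet
  simp only [Finset.mem_filter, Finset.mem_Ico]
  constructor
  · rintro ⟨⟨h1, h2⟩, h3, h4⟩
    exact ⟨h1, h3, by omega, h4⟩
  · rintro ⟨h1, h3, h5, h4⟩
    exact ⟨⟨h1, h3⟩, h3, h4⟩

lemma desSet_lt {α : Type*} [LinearOrder α] {n : ℕ} (w : Fin n → α) : ∀ i ∈ desSet w, i < n := by
  intro i hi
  rw [mem_desSet] at hi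
  exact hi.2.1

/-- letter of the inserted word, as a natural number -/
lemma ins_last_val {n : ℕ} (p : Fin (n+1)) (t : Equiv.Perm (Fin n)) (i : ℕ) (hi : i < n+1) :
    ((insP p (Fin.last n) t ⟨i, hi⟩ : Fin (n+1)) : ℕ) =
      if h : i < p then (t ⟨i, by omega⟩ : ℕ)
      else if h' : i = p then n else (t ⟨i - 1, by omega⟩ : ℕ) := by
  split_ifs with h h'
  · have : (⟨i, hi⟩ : Fin (n+1)) = p.succAbove ⟨i, by omega⟩ := by
      rw [Fin.succAbove_of_castSucc_lt]
      · rfl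
      · exact h
    rw [this, insP_above]
    simp
  · have : (⟨i, hi⟩ : Fin (n+1)) = p := Fin.ext h'
    rw [this, insP_same]
    simp
  · have : (⟨i, hi⟩ : Fin (n+1)) = p.succAbove ⟨i-1, by omega⟩ := by
      rw [Fin.succAbove_of_le_castSucc]
      · ext; simp; omega
      · rw [Fin.le_def]; simp; omega
    rw [this, insP_above]
    simp

lemma mem_desSet_ins {n : ℕ} (p : Fin (n+1)) (t : Equiv.Perm (Fin n)) (i : ℕ) :
    i ∈ desSet (insP p (Fin.last n) t) ↔
      (i < p ∧ i ∈ desSet t) ∨ (i = p + 1 ∧ (p : ℕ) < n) ∨ (p + 1 < i ∧ i - 1 ∈ desSet t) := by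
  have hp := p.2
  rw [mem_desSet, mem_desSet, mem_desSet]
  simp only [Fin.lt_def, ins_last_val]
  rcases lt_trichotomy i (p : ℕ) with h | h | h
  · constructor
    · rintro ⟨h1, h2, h3, h4⟩
      rw [dif_pos h, dif_pos (by omega)] at h4
      exact Or.inl ⟨h, h1, by omega, by omega, h4⟩
    · rintro (⟨-, h1, h2, h3, h4⟩ | h' | h')
      · refine ⟨h1, by omega, by omega, ?_⟩
        rw [dif_pos h, dif_pos (by omega)]
        exact h4
      · omega
      · omega
  · constructor
    · rintro ⟨h1, h2, h3, h4⟩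
      rw [dif_neg (by omega), dif_pos h, dif_pos (by omega)] at h4
      have := (t ⟨i-1, by omega⟩).2
      omega
    · rintro (h' | h' | h') <;> omega
  · by_cases h5 : i = p + 1
    · constructor
      · rintro ⟨h1, h2, h3, h4⟩
        exact Or.inr (Or.inl ⟨h5, by omega⟩)
      · intro _
        by_cases h6 : (p : ℕ) < n
        · refine ⟨by omega, by omega, by omega, ?_⟩
          rw [dif_neg (by omega), dif_neg (by omega), dif_neg (by omega), dif_pos (by omega)]
          exact (t _).2
        · omega
    · constructor
      · rintro ⟨h1, h2, h3, h4⟩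
        rw [dif_neg (by omega), dif_neg (by omega), dif_neg (by omega), dif_neg (by omega)] at h4
        exact Or.inr (Or.inr ⟨by omega, by omega, by omega, by omega, h4⟩)
      · rintro (h' | h' | ⟨-, h1, h2, h3, h4⟩)
        · omega
        · omega
        · refine ⟨by omega, by omega, by omega, ?_⟩
          rw [dif_neg (by omega), dif_neg (by omega), dif_neg (by omega), dif_neg (by omega)]
          exact h4

lemma desSet_ins_last {n : ℕ} (p : Fin (n+1)) (hp : (p : ℕ) = n) (t : Equiv.Perm (Fin n)) :
    desSet (insP p (Fin.last n) t) = desSet t := by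
  ext i
  rw [mem_desSet_ins]
  constructor
  · rintro (h | h | h)
    · exact h.2
    · omega
    · have := desSet_lt _ _ h.2; omega
  · intro h
    exact Or.inl ⟨by have := desSet_lt _ _ h; omega, h⟩

lemma sum_desSet_ins {n : ℕ} (p : Fin (n+1)) (hp : (p : ℕ) < n) (t : Equiv.Perm (Fin n))
    (F : ℕ → ℕ) :
    ∑ i ∈ desSet (insP p (Fin.last n) t), F i =
      ∑ i ∈ (desSet t).filter (fun i => i < (p : ℕ)), F i + F (p + 1) +
      ∑ i ∈ (desSet t).filter (fun i => (p : ℕ) < i), F (i + 1) := by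
  have h : desSet (insP p (Fin.last n) t) =
      insert ((p : ℕ) + 1) ((desSet t).filter (fun i => i < (p : ℕ)) ∪
        ((desSet t).filter (fun i => (p : ℕ) < i)).map (addRightEmbedding 1)) := by
    ext i
    rw [mem_desSet_ins]
    simp only [Finset.mem_insert, Finset.mem_union, Finset.mem_filter, Finset.mem_map,
      addRightEmbedding_apply]
    constructor
    · rintro (h | h | h)
      · exact Or.inr (Or.inl ⟨h.2, h.1⟩)
      · exact Or.inl h.1
      · exact Or.inr (Or.inr ⟨i - 1, ⟨h.2, by omega⟩, by omega⟩)
    · rintro (h | h | ⟨j, ⟨h, h'⟩, rfl⟩)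
      · exact Or.inr (Or.inl ⟨h, hp⟩)
      · exact Or.inl ⟨h.2, h.1⟩
      · exact Or.inr (Or.inr ⟨by omega, by simpa using h⟩)
  rw [h, Finset.sum_insert, Finset.sum_union, Finset.sum_map]
  · simp only [addRightEmbedding_apply]; ring
  · rw [Finset.disjoint_left]
    intro i hi hi'
    simp only [Finset.mem_filter, Finset.mem_map, addRightEmbedding_apply] at hi hi'
    obtain ⟨j, hj, hj'⟩ := hi'
    omega
  · simp only [Finset.mem_union, Finset.mem_filter, Finset.mem_map, addRightEmbedding_apply]
    rintro (h | ⟨j, hj, hj'⟩) <;> omega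

lemma split_sum (D : Finset ℕ) (p : ℕ) (F : ℕ → ℕ) :
    ∑ i ∈ D, F i = ∑ i ∈ D.filter (fun i => i < p), F i + (if p ∈ D then F p else 0)
      + ∑ i ∈ D.filter (fun i => p < i), F i := by
  have : (if p ∈ D then F p else 0) = ∑ i ∈ D, if p = i then F i else 0 := by
    rw [Finset.sum_ite_eq]
  rw [this, Finset.sum_filter, Finset.sum_filter, ← Finset.sum_add_distrib, ← Finset.sum_add_distrib]
  apply Finset.sum_congr rfl
  intro i _
  rcases lt_trichotomy i p with h | h | h
  · rw [if_pos h, if_neg (by omega), if_neg (by omega)]; ring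
  · rw [if_neg (by omega), if_pos (by omega), if_neg (by omega)]; ring
  · rw [if_neg (by omega), if_neg (by omega), if_pos h]; ring

lemma maj_ins {n : ℕ} (p : Fin (n+1)) (t : Equiv.Perm (Fin n)) :
    majStat (insP p (Fin.last n) t) = majStat t + kfun n (desSet t) p := by
  unfold majStat
  have hp := p.2
  by_cases h : (p : ℕ) < n
  · rw [sum_desSet_ins p h, split_sum (desSet t) p, Finset.sum_add_distrib, Finset.sum_const, smul_eq_mul]
    by_cases hD : (p : ℕ) ∈ desSet t
    · rw [kfun_formula' (desSet_lt _) hD, if_pos hD]; ring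
    · rw [kfun_formula (desSet_lt _) h hD, if_neg hD]; ring
  · have h : (p : ℕ) = n := by omega
    rw [desSet_ins_last p h, h, kfun_n (desSet_lt _)]
    rfl

lemma des_ins {n : ℕ} (p : Fin (n+1)) (t : Equiv.Perm (Fin n)) :
    desStat (insP p (Fin.last n) t) = desStat t +
      if desStat t < kfun n (desSet t) p then 1 else 0 := by
  unfold desStat
  have hp := p.2
  have hn : n ∉ desSet t := fun h => lt_irrefl _ (desSet_lt _ _ h)
  by_cases h : (p : ℕ) < n
  · have h1 := sum_desSet_ins p h t (fun _ => 1)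
    have h2 := split_sum (desSet t) p (fun _ => 1)
    simp only [← Finset.card_eq_sum_ones] at h1 h2
    by_cases hD : (p : ℕ) ∈ desSet t
    · have := kfun_mem (p := p) hn (by simp [hD])
      rw [if_neg (by omega)]
      rw [if_pos hD] at h2
      omega
    · have := kfun_notMem (n := n) (D := desSet t) (p := p) (by simp [hD]; omega)
      rw [if_pos this]
      rw [if_neg hD] at h2
      omega
  · have h : (p : ℕ) = n := by omega
    rw [desSet_ins_last p h, h, kfun_n (desSet_lt _)]
    simp

/-! ### Skandera's theorem on `S_n` -/

theorem skandera {M : Type*} [AddCommMonoid M] (n : ℕ) : ∀ g : ℕ → ℕ → M,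
    ∑ t : Equiv.Perm (Fin n), g (stcStat t) (invStat t) =
      ∑ t : Equiv.Perm (Fin n), g (desStat t) (majStat t) := by
  induction n with
  | zero =>
    intro g
    apply Finset.sum_congr rfl
    intro t _
    have h1 : stcStat t = 0 := by
      obtain ⟨f, -, -⟩ := stair_stc (lehmer t)
      unfold stcStat
      by_contra h
      exact (f ⟨0, Nat.pos_of_ne_zero h⟩).elim0
    rw [h1]
    congr 1
  | succ n ih =>
    intro g
    rw [sum_insP_val 0, sum_insP_pos (Fin.last n)]
    simp_rw [stc_ins, inv_ins, des_ins, maj_ins]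
    have h2 : ∀ t : Equiv.Perm (Fin n),
        ∑ p : Fin (n+1), g (desStat t + if desStat t < kfun n (desSet t) p then 1 else 0)
          (majStat t + kfun n (desSet t) p) =
        ∑ k : Fin (n+1), g (desStat t + if desStat t < (k : ℕ) then 1 else 0) (majStat t + k) :=
      fun t => sum_kfun (desSet_lt t)
        (fun k => g (desStat t + if desStat t < k then 1 else 0) (majStat t + k))
    simp_rw [h2]
    exact ih (fun d m => ∑ k : Fin (n+1), g (d + if d < (k : ℕ) then 1 else 0) (m + k))

/-! ### Signed permutations -/

section mono
variable {α β : Type*} [LinearOrder α] [LinearOrder β] {n : ℕ} {f : α → β}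

lemma desSet_comp (hf : StrictMono f) (w : Fin n → α) : desSet (fun i => f (w i)) = desSet w := by
  unfold desSet
  simp only [hf.lt_iff_lt]

lemma lehmer_comp (hf : StrictMono f) (w : Fin n → α) : lehmer (fun i => f (w i)) = lehmer w := by
  funext i
  unfold lehmer
  simp only [hf.lt_iff_lt]

lemma inv_comp (hf : StrictMono f) (w : Fin n → α) : invStat (fun i => f (w i)) = invStat w := by
  unfold invStat
  simp only [hf.lt_iff_lt]

end mono

/-- the signed value attached to the absolute value `a` -/
def sval {n : ℕ} (η : Fin n → Bool) (a : Fin n) : ℤ :=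
  if η a then -((a : ℤ) + 1) else (a : ℤ) + 1

lemma sval_neg {n : ℕ} (η : Fin n → Bool) (a : Fin n) : sval η a < 0 ↔ η a = true := by
  unfold sval
  split_ifs with h <;> simp [h] <;> omega

lemma sval_inj {n : ℕ} (η : Fin n → Bool) : Function.Injective (sval η) := by
  intro a b h
  unfold sval at h
  apply Fin.ext
  split_ifs at h <;> omega

lemma sgnWord_eq {n : ℕ} (s : Equiv.Perm (Fin n)) (η : Fin n → Bool) :
    sgnWord (s, fun i => η (s i)) = fun i => sval η (s i) := rfl

lemma symm_count {n : ℕ} (P : Fin n → Fin n → Prop) [∀ i j, Decidable (P i j)]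
    (hP : ∀ i j, P i j ↔ P j i) :
    2 * ((Finset.univ : Finset (Fin n × Fin n)).filter fun p => p.1 < p.2 ∧ P p.1 p.2).card =
      ((Finset.univ : Finset (Fin n × Fin n)).filter fun p => p.1 ≠ p.2 ∧ P p.1 p.2).card := by
  have h1 : ((Finset.univ : Finset (Fin n × Fin n)).filter fun p => p.1 < p.2 ∧ P p.1 p.2).card =
      ((Finset.univ : Finset (Fin n × Fin n)).filter fun p => p.2 < p.1 ∧ P p.1 p.2).card := by
    rw [← Finset.card_map (Equiv.prodComm (Fin n) (Fin n)).toEmbedding]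
    congr 1
    ext ⟨i, j⟩
    simp [Finset.mem_map_equiv, hP i j]
  have h2 : ((Finset.univ : Finset (Fin n × Fin n)).filter fun p => p.1 ≠ p.2 ∧ P p.1 p.2) =
      ((Finset.univ : Finset (Fin n × Fin n)).filter fun p => p.1 < p.2 ∧ P p.1 p.2) ∪
      ((Finset.univ : Finset (Fin n × Fin n)).filter fun p => p.2 < p.1 ∧ P p.1 p.2) := by
    ext ⟨i, j⟩
    simp only [Finset.mem_filter, Finset.mem_univ, true_and, Finset.mem_union]
    rw [← or_and_right, ← lt_or_lt_iff_ne]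
  rw [h2, Finset.card_union_of_disjoint, ← h1, two_mul]
  rw [Finset.disjoint_left]
  rintro ⟨i, j⟩ h h'
  simp only [Finset.mem_filter] at h h'
  exact lt_asymm h.2.1 h'.2.1

lemma nsp_perm {n : ℕ} (v : Fin n → ℤ) (s : Equiv.Perm (Fin n)) :
    nspStat (fun i => v (s i)) = nspStat v := by
  have h1 := symm_count (fun i j => v (s i) + v (s j) < 0) (fun i j => by rw [add_comm])
  have h2 := symm_count (fun i j => v i + v j < 0) (fun i j => by rw [add_comm])
  have h3 : ((Finset.univ : Finset (Fin n × Fin n)).filter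
        fun p => p.1 ≠ p.2 ∧ v (s p.1) + v (s p.2) < 0).card =
      ((Finset.univ : Finset (Fin n × Fin n)).filter fun p => p.1 ≠ p.2 ∧ v p.1 + v p.2 < 0).card := by
    rw [← Finset.card_map (Equiv.prodCongr s s).toEmbedding]
    congr 1
    ext ⟨i, j⟩
    simp [Finset.mem_map_equiv]
  unfold nspStat
  refine Nat.eq_of_mul_eq_mul_left (by norm_num : 0 < 2) ?_
  exact h1.trans (h3.trans h2.symm)

lemma neg_perm {n : ℕ} (v : Fin n → ℤ) (s : Equiv.Perm (Fin n)) :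
    negStat (fun i => v (s i)) = negStat v := by
  unfold negStat
  rw [← Finset.card_map s.toEmbedding]
  congr 1
  ext i
  simp [Finset.mem_map_equiv]

lemma negsum_perm {n : ℕ} (v : Fin n → ℤ) (s : Equiv.Perm (Fin n)) :
    ∑ i ∈ Finset.univ.filter (fun i : Fin n => v (s i) < 0), (v (s i)).natAbs =
      ∑ i ∈ Finset.univ.filter (fun i : Fin n => v i < 0), (v i).natAbs := by
  rw [Finset.sum_filter, Finset.sum_filter]
  exact Equiv.sum_comp s (fun i => if v i < 0 then (v i).natAbs else 0)

lemma neg_add_nsp {n : ℕ} (η : Fin n → Bool) :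
    negStat (sval η) + nspStat (sval η) =
      ∑ i ∈ Finset.univ.filter (fun i : Fin n => sval η i < 0), (sval η i).natAbs := by
  have h1 : nspStat (sval η) = ∑ j : Fin n, if sval η j < 0 then (j : ℕ) else 0 := by
    unfold nspStat
    rw [Finset.card_filter, ← Finset.univ_product_univ, Finset.sum_product_right]
    apply Finset.sum_congr rfl
    intro j _
    have h : ∀ i : Fin n, (i < j ∧ sval η i + sval η j < 0) ↔ (i < j ∧ sval η j < 0) := by
      intro i
      apply and_congr_right
      intro hij
      rw [Fin.lt_def] at hij
      unfold sval
      split_ifs <;> omega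
    simp only [h]
    by_cases hj : sval η j < 0
    · simp only [hj, and_true, if_true]
      rw [← Finset.card_filter]
      have : (Finset.univ.filter fun i : Fin n => i < j) = Finset.Iio j := by ext; simp
      rw [this, Fin.card_Iio]
    · simp [hj]
  rw [h1]
  unfold negStat
  rw [Finset.card_filter, ← Finset.sum_add_distrib, Finset.sum_filter]
  apply Finset.sum_congr rfl
  intro i _
  unfold sval
  split_ifs <;> omega

lemma sum_signed {n : ℕ} {M : Type*} [AddCommMonoid M] (F : SignedPerm n → M) :
    ∑ σ, F σ = ∑ η : Fin n → Bool, ∑ t : Equiv.Perm (Fin n),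
      F (Tuple.sort (sval η) * t, fun i => η ((Tuple.sort (sval η) * t) i)) := by
  rw [Fintype.sum_prod_type]
  have h1 : ∀ s : Equiv.Perm (Fin n), ∑ ε : Fin n → Bool, F (s, ε) =
      ∑ η : Fin n → Bool, F (s, fun i => η (s i)) := by
    intro s
    symm
    exact Equiv.sum_comp (Equiv.arrowCongr s.symm (Equiv.refl Bool)) (fun ε => F (s, ε))
  simp_rw [h1]
  rw [Finset.sum_comm]
  apply Finset.sum_congr rfl
  intro η _
  symm
  exact Equiv.sum_comp (Equiv.mulLeft (Tuple.sort (sval η))) (fun s => F (s, fun i => η (s i)))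

lemma sort_strict {n : ℕ} (η : Fin n → Bool) :
    StrictMono (fun i => sval η (Tuple.sort (sval η) i)) :=
  (Tuple.monotone_sort (sval η)).strictMono_of_injective
    ((sval_inj η).comp (Tuple.sort (sval η)).injective)

/-- `(nstc, ℓ)` is equidistributed with `(ndes, nmaj)` on `B_n`. -/
theorem nstc_len_equidistributed_ndes_nmaj (n : ℕ) :
    ∑ σ : SignedPerm n, xP ^ nstc σ * qP ^ lenB σ =
      ∑ σ : SignedPerm n, xP ^ ndes σ * qP ^ nmaj σ := by
  rw [sum_signed, sum_signed]
  apply Finset.sum_congr rfl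
  intro η _
  set N := negStat (sval η) with hN
  set S := ∑ i ∈ Finset.univ.filter (fun i : Fin n => sval η i < 0), (sval η i).natAbs with hS
  have key := skandera n (fun d m => xP ^ (d + N) * qP ^ (m + S))
  have hm := sort_strict η
  convert key using 1
  · apply Finset.sum_congr rfl
    intro t _
    have e1 : stcStat (fun i => sval η ((Tuple.sort (sval η) * t) i)) = stcStat t := by
      unfold stcStat
      exact congrArg stcWord (lehmer_comp hm t)
    have e2 : invStat (fun i => sval η ((Tuple.sort (sval η) * t) i)) = invStat t := inv_comp hm t
    unfold nstc lenB
    rw [sgnWord_eq, e1, e2, neg_perm, nsp_perm, add_assoc, neg_add_nsp]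
  · apply Finset.sum_congr rfl
    intro t _
    have e1 : desSet (fun i => sval η ((Tuple.sort (sval η) * t) i)) = desSet t := desSet_comp hm t
    unfold ndes nmaj desStat majStat
    rw [sgnWord_eq, e1, neg_perm, negsum_perm]
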